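/- (Eigenvalue property underlying the Hodge splitting, proof of Theorem 1.2) Let H be a connected cocommutative Hopf algebra over a field K of characteristic 0, with primitive filtration F_m. Then for every r ∈ ℤ and every m ≥ 0, (ψ_r − r^m·id_H)(F_mH) ⊆ F_{m−1}H, where F_{−1}H := 0; i.e., the r-th convolution power of the identity acts on the m-th associated graded piece of the primitive filtration as multiplication by r^m. -/

import Mathlib

open scoped TensorProduct

noncomputable section

variable (K H : Type) [Field K] [Ring H] [HopfAlgebra K H]

/-- Iterated tensor powers: `TPow m` is `H^{⊗(m+1)}`. -/
def TPow : ℕ → ModuleCat K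
  | 0 => ModuleCat.of K H
  | m + 1 => ModuleCat.of K (H ⊗[K] (TPow m))

/-- The projection `P = id − 1·ε` of `H` onto a complement of `K·1`;
it restricts to the identity on `H⁺ = ker ε`. -/
def projAug : H →ₗ[K] H :=
  LinearMap.id - (Algebra.linearMap K H) ∘ₗ (Coalgebra.counit (R := K) (A := H))

/-- The iterated reduced comultiplication: `redDelta m` restricted to `H⁺` is
`Δ̄^{[m+1]} : H⁺ → (H⁺)^{⊗(m+1)}` (viewed inside `H^{⊗(m+1)}`). -/
def redDelta : (m : ℕ) → (H →ₗ[K] TPow K H m)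
  | 0 => projAug K H
  | m + 1 => (TensorProduct.map (projAug K H) (redDelta m)) ∘ₗ (Coalgebra.comul (R := K) (A := H))

/-- The primitive filtration: `F_0 = K·1` and
`F_m = K·1 + {x ∈ H⁺ : Δ̄^{[m+1]}(x) = 0}` for `m ≥ 1`. -/
def primFil (m : ℕ) : Submodule K H :=
  Submodule.span K {(1 : H)} ⊔
    (LinearMap.ker (Coalgebra.counit (R := K) (A := H)) ⊓ LinearMap.ker (redDelta K H m))

/-- The `r`-th convolution power of the identity, for `r ∈ ℕ`. -/
def psiNat : ℕ → (H →ₗ[K] H)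
  | 0 => (Algebra.linearMap K H) ∘ₗ (Coalgebra.counit (R := K) (A := H))
  | r + 1 => (LinearMap.mul' K H) ∘ₗ
      (TensorProduct.map LinearMap.id (psiNat r)) ∘ₗ (Coalgebra.comul (R := K) (A := H))

/-- `ψ_r` for `r ∈ ℤ`, with `ψ_{−r} := ψ_r ∘ S`. -/
def psiInt : ℤ → (H →ₗ[K] H)
  | Int.ofNat r => psiNat K H r
  | Int.negSucc r => (psiNat K H (r + 1)) ∘ₗ (HopfAlgebra.antipode (R := K))

/-- `H` is cocommutative if `τ ∘ Δ = Δ`. -/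
def IsCocomm : Prop :=
  (TensorProduct.comm K H H).toLinearMap ∘ₗ (Coalgebra.comul (R := K) (A := H)) =
    Coalgebra.comul (R := K) (A := H)

open WithConv in
/-- multiplicativity for the comultiplication is stable under convolution -/
theorem aux_conv (hcc : IsCocomm K H) (f g : H →ₗ[K] H)
    (hf : Coalgebra.comul ∘ₗ f = TensorProduct.map f f ∘ₗ Coalgebra.comul (R := K) (A := H))
    (hg : Coalgebra.comul ∘ₗ g = TensorProduct.map g g ∘ₗ Coalgebra.comul (R := K) (A := H)) :
    Coalgebra.comul ∘ₗ (toConv f * toConv g).ofConv =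
      TensorProduct.map (toConv f * toConv g).ofConv (toConv f * toConv g).ofConv ∘ₗ
        Coalgebra.comul (R := K) (A := H) := by
  haveI : Coalgebra.IsCocomm K H := ⟨hcc⟩
  have h1 := LinearMap.algHom_comp_convMul_distrib (Bialgebra.comulAlgHom K H) (toConv f) (toConv g)
  have h2 := LinearMap.convMul_comp_coalgHom_distrib
    (toConv (TensorProduct.map f f)) (toConv (TensorProduct.map g g)) (Coalgebra.comulCoalgHom K H)
  have h3 := TensorProduct.map_convMul_map (f := toConv f) (h := toConv g) (g := toConv f)
    (k := toConv g)
  have h4 : (Bialgebra.comulAlgHom K H).toLinearMap = Coalgebra.comul (R := K) (A := H) := rfl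
  have h5 : (Coalgebra.comulCoalgHom K H).toLinearMap = Coalgebra.comul (R := K) (A := H) := rfl
  simp only [ofConv_toConv] at h1 h2 h3
  rw [h4, hf, hg] at h1
  rw [h3, h5] at h2
  rw [h1, ← h2]

open WithConv in
theorem aux_antipode (hcc : IsCocomm K H) :
    Coalgebra.comul ∘ₗ HopfAlgebra.antipode K =
      TensorProduct.map (HopfAlgebra.antipode K) (HopfAlgebra.antipode K) ∘ₗ
        Coalgebra.comul (R := K) (A := H) := by
  haveI : Coalgebra.IsCocomm K H := ⟨hcc⟩
  set S : H →ₗ[K] H := HopfAlgebra.antipode K with hS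
  have h1 : toConv (Coalgebra.comul (R := K) (A := H)) * toConv (Coalgebra.comul ∘ₗ S) = 1 :=
    LinearMap.comul_right_inv
  have h2 := LinearMap.convMul_comp_coalgHom_distrib
    (toConv (TensorProduct.map S S)) (toConv (TensorProduct.map (LinearMap.id : H →ₗ[K] H)
      (LinearMap.id : H →ₗ[K] H))) (Coalgebra.comulCoalgHom K H)
  have h3 := TensorProduct.map_convMul_map (f := toConv S) (h := toConv (LinearMap.id : H →ₗ[K] H))
    (g := toConv S) (k := toConv (LinearMap.id : H →ₗ[K] H))
  have h5 : (Coalgebra.comulCoalgHom K H).toLinearMap = Coalgebra.comul (R := K) (A := H) := rfl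
  simp only [ofConv_toConv] at h2 h3
  rw [h3, h5, TensorProduct.map_id, LinearMap.id_comp, hS, LinearMap.antipode_mul_id, ← hS] at h2
  have h6 : toConv (TensorProduct.map S S ∘ₗ Coalgebra.comul (R := K) (A := H)) *
      toConv (Coalgebra.comul (R := K) (A := H)) = 1 := by
    apply WithConv.ofConv_injective
    rw [← h2]
    ext x
    have := LinearMap.congr_fun (Coalgebra.rTensor_counit_comp_comul (R := K) (A := H)) x
    have e : TensorProduct.map (1 : WithConv (H →ₗ[K] H)).ofConv (1 : WithConv (H →ₗ[K] H)).ofConv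
        = TensorProduct.map (Algebra.linearMap K H)
          (Algebra.linearMap K H ∘ₗ Coalgebra.counit (R := K) (A := H)) ∘ₗ
          LinearMap.rTensor H (Coalgebra.counit (R := K) (A := H)) := by
      ext a b; simp [LinearMap.convOne_def]
    rw [e]
    simp only [LinearMap.comp_apply] at this ⊢
    rw [this]
    simp [LinearMap.convOne_def, Algebra.TensorProduct.algebraMap_apply, TensorProduct.mk_apply,
      Algebra.algebraMap_eq_smul_one, Algebra.TensorProduct.one_def, TensorProduct.smul_tmul']
  have := left_inv_eq_right_inv h6 h1
  exact (WithConv.toConv_injective this).symm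

/-- the working predicate -/
structure GoodMap (f : H →ₗ[K] H) (r : K) : Prop where
  one : f 1 = 1
  counit : ∀ x, Coalgebra.counit (R := K) (f x) = Coalgebra.counit (R := K) x
  comul : Coalgebra.comul ∘ₗ f = TensorProduct.map f f ∘ₗ Coalgebra.comul (R := K) (A := H)
  ex : ∃ E : H ⊗[K] H →ₗ[K] H, projAug K H ∘ₗ f =
    r • projAug K H + E ∘ₗ TensorProduct.map (projAug K H) (projAug K H) ∘ₗ
      Coalgebra.comul (R := K) (A := H)

variable {K H}

theorem GoodMap.comm {f : H →ₗ[K] H} {r : K} (h : GoodMap K H f r) :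
    projAug K H ∘ₗ f = f ∘ₗ projAug K H := by
  ext x
  simp [projAug, h.counit, Algebra.algebraMap_eq_smul_one, h.one]

/-- `id * f = f + P + μ(1⊗f)(P⊗P)Δ` for unital counital `f` -/
theorem conv_expand (f : H →ₗ[K] H) (h1 : f 1 = 1) :
    LinearMap.mul' K H ∘ₗ TensorProduct.map LinearMap.id f ∘ₗ Coalgebra.comul (R := K) (A := H) =
      f + projAug K H + (LinearMap.mul' K H ∘ₗ TensorProduct.map LinearMap.id f) ∘ₗ
        TensorProduct.map (projAug K H) (projAug K H) ∘ₗ Coalgebra.comul (R := K) (A := H) := by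
  ext x
  have hl := LinearMap.congr_fun (Coalgebra.rTensor_counit_comp_comul (R := K) (A := H)) x
  have hr := LinearMap.congr_fun (Coalgebra.lTensor_counit_comp_comul (R := K) (A := H)) x
  have key : LinearMap.mul' K H ∘ₗ TensorProduct.map LinearMap.id f =
      (f ∘ₗ (TensorProduct.lid K H).toLinearMap) ∘ₗ
          LinearMap.rTensor H (Coalgebra.counit (R := K) (A := H))
      + (projAug K H ∘ₗ (TensorProduct.rid K H).toLinearMap) ∘ₗ
          LinearMap.lTensor H (Coalgebra.counit (R := K) (A := H))
      + (LinearMap.mul' K H ∘ₗ TensorProduct.map LinearMap.id f) ∘ₗ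
        TensorProduct.map (projAug K H) (projAug K H) := by
    ext a b
    simp [projAug, Algebra.algebraMap_eq_smul_one, h1, mul_sub, sub_mul, smul_sub]
  have := LinearMap.congr_fun key (Coalgebra.comul (R := K) x)
  simp only [LinearMap.comp_apply, LinearMap.add_apply] at this hl hr ⊢
  rw [this, hl, hr]
  simp

theorem GoodMap.comp {f g : H →ₗ[K] H} {r s : K} (hf : GoodMap K H f r) (hg : GoodMap K H g s) :
    GoodMap K H (f ∘ₗ g) (r * s) := by
  obtain ⟨E, hE⟩ := hf.ex
  obtain ⟨F, hF⟩ := hg.ex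
  refine ⟨by simp [hf.one, hg.one], fun x => by simp [hf.counit, hg.counit], ?_,
    r • F + E ∘ₗ TensorProduct.map g g, ?_⟩
  · rw [← LinearMap.comp_assoc, hf.comul, LinearMap.comp_assoc, hg.comul, TensorProduct.map_comp,
      LinearMap.comp_assoc]
  · rw [← LinearMap.comp_assoc, hE, LinearMap.add_comp, LinearMap.smul_comp, hF,
      LinearMap.comp_assoc, LinearMap.comp_assoc, hg.comul,
      ← LinearMap.comp_assoc _ (TensorProduct.map g g), ← TensorProduct.map_comp, hg.comm,
      TensorProduct.map_comp, smul_add, smul_smul, LinearMap.add_comp, LinearMap.smul_comp, add_assoc]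
    rfl

theorem projAug_one : projAug K H 1 = 0 := by simp [projAug]

theorem projAug_projAug : projAug K H ∘ₗ projAug K H = projAug K H := by
  ext x; simp [projAug]

theorem goodMap_psiNat (hcc : IsCocomm K H) (r : ℕ) : GoodMap K H (psiNat K H r) r := by
  induction r with
  | zero =>
    refine ⟨by simp [psiNat], by simp [psiNat], ?_, 0, ?_⟩
    · ext x
      have hl := LinearMap.congr_fun (Coalgebra.rTensor_counit_comp_comul (R := K) (A := H)) x
      have e : TensorProduct.map (psiNat K H 0) (psiNat K H 0)
        = TensorProduct.map (Algebra.linearMap K H)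
          (Algebra.linearMap K H ∘ₗ Coalgebra.counit (R := K) (A := H)) ∘ₗ
          LinearMap.rTensor H (Coalgebra.counit (R := K) (A := H)) := by
        ext a b; simp [psiNat]
      rw [e]
      simp only [LinearMap.comp_apply] at hl ⊢
      rw [hl]
      simp [psiNat, Algebra.algebraMap_eq_smul_one, Algebra.TensorProduct.one_def]
    · ext x; simp [psiNat, projAug]
  | succ r ih =>
    obtain ⟨E, hE⟩ := ih.ex
    have hx := conv_expand (psiNat K H r) ih.one
    refine ⟨?_, ?_, ?_, E + projAug K H ∘ₗ
      (LinearMap.mul' K H ∘ₗ TensorProduct.map LinearMap.id (psiNat K H r)), ?_⟩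
    · simp [psiNat, Algebra.TensorProduct.one_def, ih.one]
    · intro x
      have e : Coalgebra.counit (R := K) (A := H) ∘ₗ LinearMap.mul' K H ∘ₗ
          TensorProduct.map LinearMap.id (psiNat K H r) =
          (Coalgebra.counit (R := K) (A := H) ∘ₗ (TensorProduct.lid K H).toLinearMap) ∘ₗ
          LinearMap.rTensor H (Coalgebra.counit (R := K) (A := H)) := by
        ext a b; simp [ih.counit]
      have hl := LinearMap.congr_fun (Coalgebra.rTensor_counit_comp_comul (R := K) (A := H)) x
      have := LinearMap.congr_fun e (Coalgebra.comul (R := K) x)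
      simp only [LinearMap.comp_apply] at this hl
      rw [hl] at this
      simpa [psiNat] using this
    · exact aux_conv K H hcc LinearMap.id (psiNat K H r) (by simp) ih.comul
    · rw [psiNat, hx, LinearMap.comp_add, LinearMap.comp_add, hE, projAug_projAug,
        LinearMap.add_comp]
      simp only [LinearMap.comp_assoc]
      push_cast
      module

theorem goodMap_antipode (hcc : IsCocomm K H) :
    GoodMap K H (HopfAlgebra.antipode K) (-1) := by
  have hx := conv_expand (HopfAlgebra.antipode K : H →ₗ[K] H) (by simp)
  have h0 := HopfAlgebra.mul_antipode_lTensor_comul (R := K) (A := H)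
  refine ⟨by simp, by simp, aux_antipode K H hcc, - projAug K H ∘ₗ
      (LinearMap.mul' K H ∘ₗ TensorProduct.map LinearMap.id (HopfAlgebra.antipode K)), ?_⟩
  rw [LinearMap.lTensor, hx] at h0
  have h1 := congrArg (fun g => projAug K H ∘ₗ g) h0
  simp only [LinearMap.comp_add, projAug_projAug] at h1
  have h2 : projAug K H ∘ₗ Algebra.linearMap K H ∘ₗ Coalgebra.counit (R := K) (A := H) = 0 := by
    ext x; simp [projAug]
  rw [h2, add_assoc] at h1
  rw [eq_neg_of_add_eq_zero_left h1, LinearMap.neg_comp]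
  simp only [LinearMap.comp_assoc]
  module

theorem goodMap_psiInt (hcc : IsCocomm K H) (r : ℤ) : GoodMap K H (psiInt K H r) r := by
  cases r with
  | ofNat r => simpa [psiInt] using goodMap_psiNat hcc r
  | negSucc r =>
    have := (goodMap_psiNat hcc (r + 1)).comp (goodMap_antipode hcc)
    have e : ((Int.negSucc r : ℤ) : K) = ((r + 1 : ℕ) : K) * (-1) := by
      rw [Int.cast_negSucc]; ring
    rw [e]
    exact this

theorem aux_step {f : H →ₗ[K] H} {r : K} (h : GoodMap K H f r) {M : Type} [AddCommGroup M]
    [Module K M] (D : H →ₗ[K] M) (D' : H →ₗ[K] H ⊗[K] M) (D'' : H →ₗ[K] H ⊗[K] (H ⊗[K] M))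
    (h' : D' = TensorProduct.map (projAug K H) D ∘ₗ Coalgebra.comul (R := K) (A := H))
    (h'' : D'' = TensorProduct.map (projAug K H) D' ∘ₗ Coalgebra.comul (R := K) (A := H))
    (T : M →ₗ[K] M) (E : H ⊗[K] M →ₗ[K] M) (c : K) (hT : D ∘ₗ f = T ∘ₗ D)
    (hE : D ∘ₗ f = c • D + E ∘ₗ D') :
    ∃ (T' : H ⊗[K] M →ₗ[K] H ⊗[K] M) (E' : H ⊗[K] (H ⊗[K] M) →ₗ[K] H ⊗[K] M),
      D' ∘ₗ f = T' ∘ₗ D' ∧ D' ∘ₗ f = (r * c) • D' + E' ∘ₗ D'' := by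
  obtain ⟨F, hF⟩ := h.ex
  refine ⟨TensorProduct.map f T, r • LinearMap.lTensor H E +
    TensorProduct.map F T ∘ₗ (TensorProduct.assoc K H H M).symm.toLinearMap, ?_, ?_⟩
  · rw [h', LinearMap.comp_assoc, h.comul, ← LinearMap.comp_assoc, ← TensorProduct.map_comp,
      h.comm, hT, TensorProduct.map_comp, LinearMap.comp_assoc]
  · have h1 : D' ∘ₗ f = TensorProduct.map (projAug K H ∘ₗ f) (D ∘ₗ f) ∘ₗ
        Coalgebra.comul (R := K) (A := H) := by
      rw [h', LinearMap.comp_assoc, h.comul, ← LinearMap.comp_assoc, ← TensorProduct.map_comp]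
    -- third term
    have h3 : TensorProduct.map (F ∘ₗ TensorProduct.map (projAug K H) (projAug K H) ∘ₗ
        Coalgebra.comul (R := K) (A := H)) (T ∘ₗ D) ∘ₗ Coalgebra.comul (R := K) (A := H) =
        (TensorProduct.map F T ∘ₗ (TensorProduct.assoc K H H M).symm.toLinearMap) ∘ₗ D'' := by
      have e1 : TensorProduct.map (F ∘ₗ TensorProduct.map (projAug K H) (projAug K H) ∘ₗ
          Coalgebra.comul (R := K) (A := H)) (T ∘ₗ D) =
          TensorProduct.map F T ∘ₗ TensorProduct.map (TensorProduct.map (projAug K H)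
            (projAug K H)) D ∘ₗ LinearMap.rTensor H (Coalgebra.comul (R := K) (A := H)) := by
        ext a b; simp
      have e2 : TensorProduct.map (projAug K H) D' =
          TensorProduct.map (projAug K H) (TensorProduct.map (projAug K H) D) ∘ₗ
            LinearMap.lTensor H (Coalgebra.comul (R := K) (A := H)) := by
        ext a b; simp [h']
      have e3 : TensorProduct.map (TensorProduct.map (projAug K H) (projAug K H)) D =
          (TensorProduct.assoc K H H M).symm.toLinearMap ∘ₗ
          TensorProduct.map (projAug K H) (TensorProduct.map (projAug K H) D) ∘ₗ
          (TensorProduct.assoc K H H H).toLinearMap := by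
        ext a b c; simp
      rw [e1, h'', e2, e3]
      simp only [LinearMap.comp_assoc]
      rw [Coalgebra.coassoc]
    have h2 : TensorProduct.map (projAug K H) (E ∘ₗ D') ∘ₗ Coalgebra.comul (R := K) (A := H) =
        LinearMap.lTensor H E ∘ₗ D'' := by
      rw [h'', ← LinearMap.comp_assoc]
      congr 1
      ext a b; simp
    rw [h1, hF, TensorProduct.map_add_left, LinearMap.add_comp]
    nth_rw 2 [hT]
    rw [h3, hE, TensorProduct.map_add_right, TensorProduct.map_smul_left,
      TensorProduct.map_smul_left, TensorProduct.map_smul_right, LinearMap.add_comp,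
      LinearMap.smul_comp, LinearMap.smul_comp, LinearMap.smul_comp, h2, ← h',
      LinearMap.add_comp (R₁ := K), LinearMap.smul_comp, smul_smul, add_assoc]

theorem aux_main {f : H →ₗ[K] H} {r : K} (h : GoodMap K H f r) (m : ℕ) :
    ∃ (T : TPow K H m →ₗ[K] TPow K H m) (E : H ⊗[K] TPow K H m →ₗ[K] TPow K H m),
      redDelta K H m ∘ₗ f = T ∘ₗ redDelta K H m ∧
      redDelta K H m ∘ₗ f = r ^ (m + 1) • redDelta K H m + E ∘ₗ
        (TensorProduct.map (projAug K H) (redDelta K H m) ∘ₗ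
          Coalgebra.comul (R := K) (A := H)) := by
  induction m with
  | zero =>
    obtain ⟨E, hE⟩ := h.ex
    rw [zero_add, pow_one]
    exact ⟨f, E, h.comm, hE⟩
  | succ m ih =>
    obtain ⟨T, E, hT, hE⟩ := ih
    rw [pow_succ']
    exact aux_step h (redDelta K H m) _ _ rfl rfl T E _ hT hE

variable (K H)

/-- (Eigenvalue property underlying the Hodge splitting.)
For a connected cocommutative Hopf algebra over a field of characteristic `0`, the
`r`-th convolution power of the identity acts on the `m`-th layer of the primitive
filtration as multiplication by `r^m` modulo the previous layer:
`(ψ_r − r^m·id)(F_m H) ⊆ F_{m−1} H`, with `F_{−1} H := 0`. -/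
theorem stmt_5 [CharZero K] (hcc : IsCocomm K H)
    (hconn : ∀ x : H, ∃ m : ℕ, x ∈ primFil K H m) :
    ∀ (r : ℤ) (m : ℕ) (x : H), x ∈ primFil K H m →
      psiInt K H r x - (r ^ m : ℤ) • x ∈
        (match m with
          | 0 => (⊥ : Submodule K H)
          | m' + 1 => primFil K H m') := by
  intro r m x hx
  have hg := goodMap_psiInt hcc r
  obtain ⟨y, hy, z, hz, rfl⟩ := Submodule.mem_sup.1 hx
  obtain ⟨c, rfl⟩ := Submodule.mem_span_singleton.1 hy
  cases m with
  | zero =>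
    have hz0 : z = 0 := by
      have h1 : Coalgebra.counit (R := K) z = 0 := hz.1
      have h2 : projAug K H z = 0 := hz.2
      simpa [projAug, h1] using h2
    simp [hz0, hg.one]
  | succ m =>
    have h1 : Coalgebra.counit (R := K) z = 0 := hz.1
    have h2 : (TensorProduct.map (projAug K H) (redDelta K H m) ∘ₗ
          Coalgebra.comul (R := K) (A := H)) z = 0 := hz.2
    obtain ⟨T, E, -, hE⟩ := aux_main hg m
    have h3 := LinearMap.congr_fun hE z
    rw [LinearMap.add_apply, LinearMap.comp_apply E, h2, map_zero, add_zero] at h3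
    have e : ∀ w : H, (r ^ (m + 1) : ℤ) • w = ((r : K) ^ (m + 1)) • w := by
      intro w
      rw [← Int.cast_smul_eq_zsmul K]
      push_cast
      rfl
    refine Submodule.mem_sup.2 ⟨(c - (r : K) ^ (m + 1) * c) • 1,
      Submodule.smul_mem _ _ (Submodule.mem_span_singleton_self _),
      psiInt K H r z - ((r : K) ^ (m + 1)) • z, ⟨?_, ?_⟩, ?_⟩
    · simp [hg.counit, h1]
    · rw [SetLike.mem_coe, LinearMap.mem_ker, map_sub, map_smul]
      exact sub_eq_zero.2 h3
    · rw [e, map_add, map_smul, hg.one]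
      module

end
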